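/- Define g : ℝ → ℝ by g(λ) = ‖P_v(λ)ᵀ C P_t(λ)‖_F², where P_v(λ) = I − λ U_k U_kᵀ and P_t(λ) = I − λ W_k W_kᵀ. Then for every λ the derivative of g at λ equals −4(1 − λ)³ Σ_{i=1}^k σ_i²; consequently, if Σ_{i=1}^k σ_i² > 0, then g is strictly decreasing on the interval [0, 1], i.e., increasing the soft projection strength λ monotonically reduces the redundancy penalty ‖C̃‖_F². -/

import Mathlib

open Matrix Finset

/-- The projection onto the first `k` columns of a square matrix, as a masked diagonal form. -/
lemma submatrix_castLE_mul_transpose {d k : ℕ} (hk : k ≤ d) (V : Matrix (Fin d) (Fin d) ℝ) :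
    V.submatrix id (Fin.castLE hk) * (V.submatrix id (Fin.castLE hk))ᵀ =
      V * Matrix.diagonal (fun i : Fin d => if (i : ℕ) < k then (1 : ℝ) else 0) * Vᵀ := by
  obtain ⟨m, rfl⟩ := Nat.exists_eq_add_of_le hk
  ext i j
  rw [Matrix.mul_apply, Matrix.mul_apply, Fin.sum_univ_add]
  simp only [Matrix.mul_diagonal, Matrix.transpose_apply, Matrix.submatrix_apply, id_eq,
    Fin.val_castAdd, Fin.val_natAdd, Fin.is_lt, if_true, mul_one, not_lt.mpr (Nat.le_add_right k _),
    if_false, mul_zero, zero_mul, Finset.sum_const_zero, add_zero]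
  rfl

/-- A soft projection along the first `k` columns of an orthogonal matrix `V` is diagonalised
by `V`. -/
lemma one_sub_smul_submatrix_castLE {d k : ℕ} (hk : k ≤ d) {V : Matrix (Fin d) (Fin d) ℝ}
    (hV : Vᵀ * V = 1) (c : ℝ) :
    1 - c • (V.submatrix id (Fin.castLE hk) * (V.submatrix id (Fin.castLE hk))ᵀ) =
      V * Matrix.diagonal (fun i : Fin d => if (i : ℕ) < k then 1 - c else 1) * Vᵀ := by
  have hdiag : Matrix.diagonal (fun i : Fin d => if (i : ℕ) < k then 1 - c else 1) =
      1 - c • Matrix.diagonal (fun i : Fin d => if (i : ℕ) < k then (1 : ℝ) else 0) := by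
    rw [← Matrix.diagonal_one, ← Matrix.diagonal_smul, Matrix.diagonal_sub]
    congr 1
    ext i
    by_cases h : (i : ℕ) < k <;> simp [h]
  rw [submatrix_castLE_mul_transpose, hdiag, mul_sub, sub_mul, mul_one,
    mul_eq_one_comm.mp hV, Matrix.mul_smul, Matrix.smul_mul]

lemma sum_sq_entries_eq_trace {n : Type*} [Fintype n] (A : Matrix n n ℝ) :
    ∑ i, ∑ j, A i j ^ 2 = (Aᵀ * A).trace := by
  rw [Finset.sum_comm]
  simp [Matrix.trace, Matrix.mul_apply, sq]

/-- The squared Frobenius norm of `U * diagonal s * Wᵀ` for orthogonal `U` and `W`. -/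
lemma sum_sq_entries_mul_diagonal_mul_transpose {n : Type*} [Fintype n] [DecidableEq n]
    {U W : Matrix n n ℝ} (hU : Uᵀ * U = 1) (hW : Wᵀ * W = 1) (s : n → ℝ) :
    ∑ i, ∑ j, (U * Matrix.diagonal s * Wᵀ) i j ^ 2 = ∑ i, s i ^ 2 := by
  have h : (U * Matrix.diagonal s * Wᵀ)ᵀ * (U * Matrix.diagonal s * Wᵀ) =
      W * (Matrix.diagonal s * (Uᵀ * U) * Matrix.diagonal s * Wᵀ) := by
    simp only [Matrix.transpose_mul, Matrix.transpose_transpose, Matrix.diagonal_transpose,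
      Matrix.mul_assoc]
  rw [sum_sq_entries_eq_trace, h, Matrix.trace_mul_comm, Matrix.mul_assoc _ Wᵀ W, hW, hU, mul_one,
    mul_one, Matrix.diagonal_mul_diagonal, Matrix.trace_diagonal]
  simp only [sq]

/-- **Soft projection monotonically reduces redundancy.**  Define
`g(λ) = ‖P_v(λ)ᵀ C P_t(λ)‖_F²` with `P_v(λ) = I − λ U_k U_kᵀ`,
`P_t(λ) = I − λ W_k W_kᵀ`, where `C = U Σ Wᵀ` for orthogonal `U, W` and
`Σ = diagonal σ`.  Then `g'(λ) = −4 (1 − λ)³ ∑_{i ≤ k} σ_i²` for every `λ`, and if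
`∑_{i ≤ k} σ_i² > 0` then `g` is strictly decreasing on `[0, 1]`. -/
theorem soft_projection_redundancy_decreasing
    (d k : ℕ) (hd : 1 ≤ d) (hk1 : 1 ≤ k) (hk : k ≤ d)
    (U W : Matrix (Fin d) (Fin d) ℝ)
    (hU : Uᵀ * U = 1) (hW : Wᵀ * W = 1)
    (σ : Fin d → ℝ)
    (C : Matrix (Fin d) (Fin d) ℝ)
    (hC : C = U * Matrix.diagonal σ * Wᵀ)
    (Uk : Matrix (Fin d) (Fin k) ℝ) (hUk : Uk = U.submatrix id (Fin.castLE hk))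
    (Wk : Matrix (Fin d) (Fin k) ℝ) (hWk : Wk = W.submatrix id (Fin.castLE hk))
    (g : ℝ → ℝ)
    (hg : ∀ lam : ℝ, g lam =
      ∑ i : Fin d, ∑ j : Fin d,
        ((((1 : Matrix (Fin d) (Fin d) ℝ) - lam • (Uk * Ukᵀ))ᵀ * C * ((1 : Matrix (Fin d) (Fin d) ℝ) - lam • (Wk * Wkᵀ))) i j) ^ 2) :
    (∀ lam : ℝ, HasDerivAt g
        (-4 * (1 - lam) ^ 3 *
          ∑ i ∈ Finset.univ.filter (fun i : Fin d => (i : ℕ) < k), σ i ^ 2) lam) ∧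
    ((0 < ∑ i ∈ Finset.univ.filter (fun i : Fin d => (i : ℕ) < k), σ i ^ 2) →
      StrictAntiOn g (Set.Icc (0 : ℝ) 1)) := by
  have hg' : ∀ c : ℝ, g c =
      (1 - c) ^ 4 * ∑ i ∈ Finset.univ.filter (fun i : Fin d => (i : ℕ) < k), σ i ^ 2 +
        ∑ i ∈ Finset.univ.filter (fun i : Fin d => ¬ (i : ℕ) < k), σ i ^ 2 := by
    intro c
    set D := Matrix.diagonal (fun i : Fin d => if (i : ℕ) < k then 1 - c else 1) with hD
    have hprod : (U * D * Uᵀ)ᵀ * (U * Matrix.diagonal σ * Wᵀ) * (W * D * Wᵀ) =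
        U * (D * (Uᵀ * U) * Matrix.diagonal σ * (Wᵀ * W) * D) * Wᵀ := by
      simp only [hD, Matrix.transpose_mul, Matrix.transpose_transpose, Matrix.diagonal_transpose,
        Matrix.mul_assoc]
    rw [hg, hC, hUk, hWk, one_sub_smul_submatrix_castLE hk hU, one_sub_smul_submatrix_castLE hk hW,
      hprod, hU, hW, mul_one, mul_one, hD, Matrix.diagonal_mul_diagonal,
      Matrix.diagonal_mul_diagonal, sum_sq_entries_mul_diagonal_mul_transpose hU hW,
      ← Finset.sum_filter_add_sum_filter_not _ (fun i : Fin d => (i : ℕ) < k), Finset.mul_sum]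
    congr 1 <;> refine Finset.sum_congr rfl fun i hi => ?_
    · rw [if_pos (Finset.mem_filter.mp hi).2]
      ring
    · rw [if_neg (Finset.mem_filter.mp hi).2]
      ring
  constructor
  · intro c
    rw [funext hg']
    refine (((((hasDerivAt_id c).const_sub 1).pow 4).mul_const _).add_const _).congr_deriv ?_
    norm_num
  · intro hpos x _ y hy hxy
    rw [hg', hg']
    have : (1 - y) ^ 4 < (1 - x) ^ 4 :=
      pow_lt_pow_left₀ (by linarith) (by linarith [hy.2]) (by norm_num)
    gcongr
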